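/- Let 0 → M' → M → M'' → 0 be a short exact sequence of finitely generated modules over a noetherian local ring A, where M' and M'' are i-th syzygies of finite projective dimension. Then M is also an i-th syzygy of finite projective dimension. -/

import Mathlib

open CategoryTheory

noncomputable section

/-- We equip module categories with their standard derived category structure,
so that small `Ext`-groups are available. -/
instance extHDC (R : Type) [CommRing R] : HasDerivedCategory (ModuleCat.{0} R) :=
  HasDerivedCategory.standard _

instance extHasExt (R : Type) [CommRing R] : HasExt.{1} (ModuleCat.{0} R) :=
  hasExt_of_hasDerivedCategory _

/-- The `Ext`-group `Ext^n_R(M, N)` of two `R`-modules. -/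
abbrev extGrp (R : Type) [CommRing R] (M N : Type) [AddCommGroup M] [Module R M]
    [AddCommGroup N] [Module R N] (n : ℕ) : Type 1 :=
  Abelian.Ext (ModuleCat.of R M) (ModuleCat.of R N) n

/-- `IsSyzygy A i M` : `M` is an `i`-th syzygy, i.e. there is an exact sequence
`0 → M → F_{i-1} → ⋯ → F_0` with the `F_j` finitely generated free. -/
def IsSyzygy (A : Type) [CommRing A] : ℕ → (M : Type) → [AddCommGroup M] → [Module A M] → Prop
  | 0, _M, _, _ => True
  | (i+1), M, _, _ => ∃ (n : ℕ) (f : M →ₗ[A] (Fin n → A)), Function.Injective f ∧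
      IsSyzygy A i ((Fin n → A) ⧸ LinearMap.range f)

/-- `M` has finite projective dimension: `Ext^i(M, -)` vanishes for all large `i`. -/
def HasFinitePD (R : Type) [CommRing R] (M : Type) [AddCommGroup M] [Module R M] : Prop :=
  ∃ n : ℕ, ∀ i : ℕ, n < i → ∀ N : ModuleCat.{0} R,
    Subsingleton (Abelian.Ext (ModuleCat.of R M) N i)

/-- `M` has finite injective dimension: `Ext^i(-, M)` vanishes for all large `i`. -/
def HasFiniteInjDim (R : Type) [CommRing R] (M : Type) [AddCommGroup M] [Module R M] : Prop :=
  ∃ n : ℕ, ∀ i : ℕ, n < i → ∀ N : ModuleCat.{0} R,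
    Subsingleton (Abelian.Ext N (ModuleCat.of R M) i)


namespace Syz
open CategoryTheory Abelian

/-- projective dimension at most `n` -/
abbrev PD (R : Type) [CommRing R] (N : Type) [AddCommGroup N] [Module R N] (n : ℕ) : Prop :=
  HasProjectiveDimensionLE (ModuleCat.of R N) n

/-- vanishing of `Ext` -/
def EZ (R : Type) [CommRing R] (K N : Type) [AddCommGroup K] [Module R K]
    [AddCommGroup N] [Module R N] (j : ℕ) : Prop :=
  ∀ e : extGrp R K N j, e = 0

section basic
variable {R : Type} [CommRing R] {K L M N : Type} [AddCommGroup K] [Module R K]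
  [AddCommGroup L] [Module R L] [AddCommGroup M] [Module R M] [AddCommGroup N] [Module R N]

lemma zero_of_exact {f : L →ₗ[R] M} {g : M →ₗ[R] N} (h : Function.Exact f g) :
    g.comp f = 0 := h.linearMap_comp_eq_zero

lemma shortExact {f : L →ₗ[R] M} {g : M →ₗ[R] N} (hf : Function.Injective f)
    (hg : Function.Surjective g) (h : Function.Exact f g) :
    (ModuleCat.shortComplexOfCompEqZero f g (zero_of_exact h)).ShortExact where
  exact := (ShortComplex.ShortExact.moduleCat_exact_iff_function_exact _).mpr h
  mono_f := (ModuleCat.mono_iff_injective _).mpr hf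
  epi_g := (ModuleCat.epi_iff_surjective _).mpr hg

lemma exact_ker (g : M →ₗ[R] N) : Function.Exact (LinearMap.ker g).subtype g := by
  intro x; simp

lemma PD.mono {m n : ℕ} (hmn : m ≤ n) (h : PD R N m) : PD R N n :=
  hasProjectiveDimensionLT_of_ge _ (m + 1) (n + 1) (by omega)

lemma PD.mid {f : L →ₗ[R] M} {g : M →ₗ[R] N} (hf : Function.Injective f)
    (hg : Function.Surjective g) (h : Function.Exact f g) {n : ℕ} (h1 : PD R L n)
    (h2 : PD R N n) : PD R M n :=
  (shortExact hf hg h).hasProjectiveDimensionLT_X₂ (n + 1) h1 h2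

lemma PD.proj_iff : PD R N 0 ↔ Module.Projective R N := by
  rw [PD, HasProjectiveDimensionLE, zero_add, ← projective_iff_hasProjectiveDimensionLT_one,
    ← IsProjective.iff_projective]

lemma PD.shift {f : L →ₗ[R] M} {g : M →ₗ[R] N} (hf : Function.Injective f)
    (hg : Function.Surjective g) (h : Function.Exact f g) [Module.Projective R M] (n : ℕ) :
    PD R N (n + 1) ↔ PD R L n :=
  (shortExact hf hg h).hasProjectiveDimensionLT_X₃_iff n
    ((IsProjective.iff_projective (R := R) M).mp inferInstance)

lemma PD.equiv (e : M ≃ₗ[R] N) {n : ℕ} (h : PD R M n) : PD R N n :=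
  ModuleCat.hasProjectiveDimensionLE_of_linearEquiv (M := ModuleCat.of R M)
    (N := ModuleCat.of R N) e n

lemma PD.loc (S : Submonoid R) {n : ℕ} (h : PD R N n) :
    PD (Localization S) (LocalizedModule S N) n := by
  have := ModuleCat.localizedModule_hasProjectiveDimensionLE n S (ModuleCat.of R N)
  exact ModuleCat.hasProjectiveDimensionLE_of_linearEquiv
    (M := (ModuleCat.of R N).localizedModule S)
    (N := ModuleCat.of (Localization S) (LocalizedModule S N))
    (Shrink.linearEquiv (Localization S) (LocalizedModule S N)) n

lemma finitePD_iff : HasFinitePD R N ↔ ∃ n, PD R N n := by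
  constructor
  · rintro ⟨n, hn⟩
    exact ⟨n, HasProjectiveDimensionLT.mk fun i hi Y e ↦ (hn i hi Y).elim _ _⟩
  · rintro ⟨n, hn⟩
    exact ⟨n, fun i hi Y ↦ HasProjectiveDimensionLT.subsingleton _ (n + 1) i hi Y⟩

/-- retracts -/
lemma EZ.retract (f : M →ₗ[R] N) (g : N →ₗ[R] M) (h : g.comp f = LinearMap.id) {j : ℕ}
    (hz : EZ R K N j) : EZ R K M j := by
  intro e
  have h1 : e.comp (Ext.mk₀ (ModuleCat.ofHom f)) (add_zero j) = 0 := hz _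
  have h2 : ModuleCat.ofHom f ≫ ModuleCat.ofHom g = 𝟙 (ModuleCat.of R M) := by
    rw [← ModuleCat.ofHom_comp, h]; rfl
  have h3 : (e.comp (Ext.mk₀ (ModuleCat.ofHom f)) (add_zero j)).comp
      (Ext.mk₀ (ModuleCat.ofHom g)) (add_zero j) = e := by
    rw [Ext.comp_assoc_of_third_deg_zero, Ext.mk₀_comp_mk₀, h2, Ext.comp_mk₀_id]
  rw [← h3, h1, Ext.zero_comp]

lemma EZ.mid {f : L →ₗ[R] M} {g : M →ₗ[R] N} (hf : Function.Injective f)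
    (hg : Function.Surjective g) (h : Function.Exact f g) {j : ℕ} (h1 : EZ R K L j)
    (h2 : EZ R K N j) : EZ R K M j := by
  intro e
  obtain ⟨x, hx⟩ := Ext.covariant_sequence_exact₂ _ (shortExact hf hg h) e (h2 _)
  rw [← hx, h1 x, Ext.zero_comp]

lemma EZ.right {f : L →ₗ[R] M} {g : M →ₗ[R] N} (hf : Function.Injective f)
    (hg : Function.Surjective g) (h : Function.Exact f g) {j : ℕ} (h1 : EZ R K L (j + 1))
    (h2 : EZ R K M j) : EZ R K N j := by
  intro e
  obtain ⟨x, hx⟩ := Ext.covariant_sequence_exact₃ _ (shortExact hf hg h) e rfl (h1 _)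
  rw [← hx, h2 x, Ext.zero_comp]

/-- left term: if the map induced by `f` vanishes -/
lemma EZ.left {f : L →ₗ[R] M} {g : M →ₗ[R] N} (hf : Function.Injective f)
    (hg : Function.Surjective g) (h : Function.Exact f g) {j : ℕ}
    (h1 : ∀ e : extGrp R K L (j + 1), e.comp (Ext.mk₀ (ModuleCat.ofHom f)) (add_zero _) = 0)
    (h2 : EZ R K N j) : EZ R K L (j + 1) := by
  intro e
  obtain ⟨x, hx⟩ := Ext.covariant_sequence_exact₁ _ (shortExact hf hg h) e (h1 e) rfl
  rw [← hx, h2 x, Ext.zero_comp]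

lemma EZ.zero_left {f : L →ₗ[R] M} (hf : Function.Injective f)
    (h1 : ∀ e : extGrp R K L 0, e.comp (Ext.mk₀ (ModuleCat.ofHom f)) (add_zero _) = 0) :
    EZ R K L 0 := by
  intro e
  have : Mono (ModuleCat.ofHom f) := (ModuleCat.mono_iff_injective _).mpr hf
  apply Ext.postcomp_mk₀_injective_of_mono _ (ModuleCat.ofHom f)
  simpa using h1 e

lemma EZ.zero_hom (h : EZ R K N 0) (f : K →ₗ[R] N) : f = 0 := by
  have := h (Ext.mk₀ (ModuleCat.ofHom f))
  rw [Ext.mk₀_eq_zero_iff] at this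
  exact congrArg ModuleCat.Hom.hom this

lemma EZ.subsingleton [Subsingleton N] (j : ℕ) : EZ R K N j :=
  EZ.retract (N := PUnit) (M := N) 0 0 (by ext; exact Subsingleton.elim _ _) (by
    intro e
    have : (𝟙 (ModuleCat.of R PUnit)) = 0 := by ext
    rw [← Ext.comp_mk₀_id e, this, Ext.mk₀_zero, Ext.comp_zero])

lemma EZ.pi {j : ℕ} (h : EZ R K R j) (n : ℕ) : EZ R K (Fin n → R) j := by
  intro e
  have h2 : 𝟙 (ModuleCat.of R (Fin n → R)) = ∑ i : Fin n,
      ModuleCat.ofHom (LinearMap.proj i) ≫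
      ModuleCat.ofHom (LinearMap.single R (fun _ : Fin n ↦ R) i) := by
    ext x k
    simp
  rw [← Ext.comp_mk₀_id e, h2, Ext.mk₀_sum, Ext.comp_sum]
  refine Finset.sum_eq_zero fun i _ ↦ ?_
  rw [← Ext.mk₀_comp_mk₀, ← Ext.comp_assoc_of_third_deg_zero,
    h (e.comp (Ext.mk₀ (ModuleCat.ofHom (LinearMap.proj i))) (add_zero j)), Ext.zero_comp]

end basic
end Syz

namespace Syz
open CategoryTheory Abelian IsLocalRing
open scoped TensorProduct

section local_
variable {R : Type} [CommRing R] [IsLocalRing R] {M N : Type}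
  [AddCommGroup M] [Module R M] [AddCommGroup N] [Module R N]

local notation "κ" => ResidueField R

lemma smul_ext_zero {j : ℕ} (e : extGrp R κ N j) (a : R) (ha : a ∈ maximalIdeal R) :
    a • e = 0 := by
  have h : a • 𝟙 (ModuleCat.of R κ) = 0 := by
    ext x
    have : (residue R a) = 0 := (residue_eq_zero_iff a).mpr ha
    change a • x = 0
    rw [Algebra.smul_def]
    change residue R a * x = 0
    rw [this, zero_mul]
  have h2 : e = (Ext.mk₀ (𝟙 (ModuleCat.of R κ))).comp e (zero_add j) := (Ext.mk₀_id_comp e).symm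
  rw [h2, ← Ext.smul_comp, ← Ext.mk₀_smul, h, Ext.mk₀_zero, Ext.zero_comp]

lemma comp_zero_of_mem {j : ℕ} (e : extGrp R κ M j) (φ : M →ₗ[R] N)
    (hφ : φ ∈ (maximalIdeal R) • (⊤ : Submodule R (M →ₗ[R] N))) :
    e.comp (Ext.mk₀ (ModuleCat.ofHom φ)) (add_zero _) = 0 := by
  induction hφ using Submodule.smul_induction_on' with
  | smul a ha g _ =>
    have : ModuleCat.ofHom (a • g) = a • ModuleCat.ofHom g := rfl
    rw [this, Ext.mk₀_smul, Ext.comp_smul, ← Ext.smul_comp, smul_ext_zero e a ha, Ext.zero_comp]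
  | add x _ y _ hx hy =>
    have : ModuleCat.ofHom (x + y) = ModuleCat.ofHom x + ModuleCat.ofHom y := rfl
    rw [this, Ext.mk₀_add, Ext.comp_add, hx, hy, add_zero]

lemma mem_of_range_le [Module.Free R M] [Module.Finite R M] (φ : M →ₗ[R] N)
    (hφ : LinearMap.range φ ≤ (maximalIdeal R) • (⊤ : Submodule R N)) :
    φ ∈ (maximalIdeal R) • (⊤ : Submodule R (M →ₗ[R] N)) := by
  classical
  let b := Module.Free.chooseBasis R M
  have h : φ = ∑ i, (b.coord i).smulRight (φ (b i)) := by
    refine b.ext fun k ↦ ?_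
    simp [Finsupp.single_apply]
  rw [h]
  refine Submodule.sum_mem _ fun i _ ↦ ?_
  have h1 : φ (b i) ∈ (maximalIdeal R) • (⊤ : Submodule R N) := hφ ⟨_, rfl⟩
  have h2 := Submodule.mem_map_of_mem (f := LinearMap.smulRightₗ (b.coord i) (M := N)) h1
  rw [Submodule.map_smul''] at h2
  exact Submodule.smul_mono le_rfl le_top h2

lemma exists_minimal_cover [Module.Finite R N] :
    ∃ (n : ℕ) (g : (Fin n → R) →ₗ[R] N), Function.Surjective g ∧
      LinearMap.ker g ≤ (maximalIdeal R) • (⊤ : Submodule R (Fin n → R)) := by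
  let b := Module.finBasis κ (κ ⊗[R] N)
  obtain ⟨v, hv⟩ := (TensorProduct.mk_surjective R N κ Ideal.Quotient.mk_surjective).comp_left b
  refine ⟨_, Fintype.linearCombination R v, ?_, ?_⟩
  · rw [← LinearMap.range_eq_top, Fintype.range_linearCombination]
    exact span_eq_top_of_tmul_eq_basis v b (congr_fun hv)
  · intro x hx
    have h1 : ∑ i, x i • v i = 0 := by simpa [Fintype.linearCombination_apply] using hx
    have h2 := congrArg (TensorProduct.mk R κ N 1) h1
    rw [map_sum, map_zero] at h2
    have h3 : ∑ i, (residue R (x i)) • b i = 0 := by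
      rw [← h2]
      refine Finset.sum_congr rfl fun i _ ↦ ?_
      rw [map_smul, ← congr_fun hv i]
      exact algebraMap_smul κ (x i) _
    have h4 : ∀ i, x i ∈ maximalIdeal R := fun i ↦
      (residue_eq_zero_iff _).mp (Fintype.linearIndependent_iff.mp b.linearIndependent _ h3 i)
    rw [pi_eq_sum_univ' x]
    exact Submodule.sum_mem _ fun i _ ↦ Submodule.smul_mem_smul (h4 i) trivial

lemma ab_aux [IsNoetherianRing R] (d : ℕ) (hd : ¬ EZ R κ R d) (hlt : ∀ j < d, EZ R κ R j)
    (m : ℕ) : ∀ (N : Type) [AddCommGroup N] [Module R N] [Module.Finite R N],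
      PD R N (m + 1) → ¬ PD R N m → ∃ e, d = e + m + 1 ∧ ¬ EZ R κ N e := by
  induction m with
  | zero =>
    intro N _ _ _ h1 h0
    obtain ⟨n, g, hg, hk⟩ := exists_minimal_cover (R := R) (N := N)
    have hp : Module.Projective R (LinearMap.ker g) := PD.proj_iff.mp
      ((PD.shift (LinearMap.ker g).injective_subtype hg (exact_ker g) 0).mp h1)
    have hfree : Module.Free R (LinearMap.ker g) := Module.free_of_flat_of_isLocalRing
    have hz : ∀ (j : ℕ) (e : extGrp R κ (LinearMap.ker g) j),
        e.comp (Ext.mk₀ (ModuleCat.ofHom (LinearMap.ker g).subtype)) (add_zero _) = 0 :=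
      fun j e ↦ comp_zero_of_mem e _ (mem_of_range_le _ (by simpa using hk))
    have hne : ¬ EZ R κ (LinearMap.ker g) d := by
      intro hE
      by_cases hs : Subsingleton (LinearMap.ker g)
      · apply h0
        rw [PD.proj_iff]
        have hinj : Function.Injective g := by
          rw [← LinearMap.ker_eq_bot]
          exact (Submodule.subsingleton_iff_eq_bot).mp hs
        exact Module.Projective.of_equiv (LinearEquiv.ofBijective g ⟨hinj, hg⟩)
      · have hnt : Nontrivial (LinearMap.ker g) := not_subsingleton_iff_nontrivial.mp hs
        let b := Module.Free.chooseBasis R (LinearMap.ker g)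
        obtain ⟨i⟩ := b.index_nonempty
        apply hd
        refine EZ.retract (LinearMap.toSpanSingleton R _ (b i)) (b.coord i) ?_ hE
        ext
        simp
    rcases d with _ | e
    · exact absurd (EZ.zero_left (LinearMap.ker g).injective_subtype (hz 0)) hne
    · exact ⟨e, rfl, fun hE ↦ hne
        (EZ.left (LinearMap.ker g).injective_subtype hg (exact_ker g) (hz _) hE)⟩
  | succ m ih =>
    intro N _ _ _ h1 h0
    obtain ⟨n, g, hg, hk⟩ := exists_minimal_cover (R := R) (N := N)
    rw [PD.shift (LinearMap.ker g).injective_subtype hg (exact_ker g)] at h1 h0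
    obtain ⟨e, he, hE⟩ := ih (LinearMap.ker g) h1 h0
    have hF : EZ R κ (Fin n → R) e := (hlt e (by omega)).pi n
    rcases e with _ | e
    · exact absurd (EZ.zero_left (LinearMap.ker g).injective_subtype fun x ↦ hF _) hE
    · exact ⟨e, by omega, fun hE' ↦ hE
        (EZ.left (LinearMap.ker g).injective_subtype hg (exact_ker g) (fun x ↦ hF _) hE')⟩

/-- finite projective dimension is bounded by the depth -/
lemma ab [IsNoetherianRing R] [Module.Finite R N] (hN : ∃ n, PD R N n) (m : ℕ)
    (hm : ¬ PD R N m) (j : ℕ) (hj : j ≤ m) : EZ R κ R j := by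
  classical
  by_contra hE
  have hex : ∃ j, ¬ EZ R κ R j := ⟨j, hE⟩
  have hq : Nat.find hN ≠ 0 := fun h ↦ hm ((Nat.find_spec hN).mono (by omega))
  obtain ⟨q, hq⟩ := Nat.exists_eq_succ_of_ne_zero hq
  have hq1 : PD R N (q + 1) := by have := Nat.find_spec hN; rwa [hq] at this
  have hq0 : ¬ PD R N q := Nat.find_min hN (by omega)
  have hmq : m ≤ q := by
    by_contra hlt
    exact hm (hq1.mono (by omega))
  obtain ⟨e, he, -⟩ := ab_aux (Nat.find hex) (Nat.find_spec hex)
    (fun j hj ↦ by simpa using Nat.find_min hex hj) q N hq1 hq0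
  have := Nat.find_min' hex hE
  omega

/-- easy half of Auslander-Buchsbaum -/
lemma depth_ge [IsNoetherianRing R] (m : ℕ) : ∀ (N : Type) [AddCommGroup N] [Module R N]
    [Module.Finite R N] (j : ℕ), PD R N m → (∀ i ≤ m + j, EZ R κ R i) → EZ R κ N j := by
  induction m with
  | zero =>
    intro N _ _ _ j hN h
    obtain ⟨n, g, hg, hk⟩ := exists_minimal_cover (R := R) (N := N)
    have := PD.proj_iff.mp hN
    obtain ⟨s, hs⟩ := Module.projective_lifting_property g LinearMap.id hg
    exact EZ.retract s g hs ((h j (by omega)).pi n)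
  | succ m ih =>
    intro N _ _ _ j hN h
    obtain ⟨n, g, hg, hk⟩ := exists_minimal_cover (R := R) (N := N)
    rw [PD.shift (LinearMap.ker g).injective_subtype hg (exact_ker g)] at hN
    exact EZ.right (LinearMap.ker g).injective_subtype hg (exact_ker g)
      (ih _ (j + 1) hN (fun i hi ↦ h i (by omega))) ((h j (by omega)).pi n)

end local_
end Syz

namespace Syz
open CategoryTheory Abelian IsLocalRing

/-- the local condition -/
def LocP (R : Type) [CommRing R] [IsLocalRing R] (N : Type) [AddCommGroup N] [Module R N]
    (i : ℕ) : Prop :=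
  ∀ m, ¬ PD R N m → ∀ j ≤ m + i, EZ R (ResidueField R) R j

/-- the global condition -/
def GP (A : Type) [CommRing A] (N : Type) [AddCommGroup N] [Module A N] (i : ℕ) : Prop :=
  ∀ (p : Ideal A) [p.IsPrime],
    LocP (Localization.AtPrime p) (LocalizedModule p.primeCompl N) i

section
variable {A : Type} [CommRing A] {L M N : Type}
  [AddCommGroup L] [Module A L] [AddCommGroup M] [Module A M] [AddCommGroup N] [Module A N]

lemma loc_exact (S : Submonoid A) {f : L →ₗ[A] M} {g : M →ₗ[A] N} (h : Function.Exact f g) :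
    Function.Exact (LocalizedModule.map S f) (LocalizedModule.map S g) :=
  LocalizedModule.map_exact S f g h

lemma GP.mid {f : L →ₗ[A] M} {g : M →ₗ[A] N} (hf : Function.Injective f)
    (hg : Function.Surjective g) (h : Function.Exact f g) {i : ℕ} (h1 : GP A L i)
    (h2 : GP A N i) : GP A M i := by
  intro p _ m hm j hj
  by_cases hL : PD (Localization.AtPrime p) (LocalizedModule p.primeCompl L) m
  · by_cases hN : PD (Localization.AtPrime p) (LocalizedModule p.primeCompl N) m
    · exact absurd (PD.mid (LocalizedModule.map_injective p.primeCompl f hf)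
        (LocalizedModule.map_surjective p.primeCompl g hg) (loc_exact _ h) hL hN) hm
    · exact h2 p m hN j hj
  · exact h1 p m hL j hj

lemma exact_mkQ (f : L →ₗ[A] M) : Function.Exact f (LinearMap.range f).mkQ := by
  intro x; simp

lemma gp_of_syzygy [IsNoetherianRing A] (i : ℕ) : ∀ (N : Type) [AddCommGroup N] [Module A N]
    [Module.Finite A N], IsSyzygy A i N → (∃ n, PD A N n) → GP A N i := by
  induction i with
  | zero =>
    intro N _ _ _ _ ⟨n, hn⟩ p _ m hm j hj
    exact ab ⟨n, hn.loc _⟩ m hm j hj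
  | succ i ih =>
    rintro N _ _ _ ⟨k, f, hf, hC⟩ ⟨n, hn⟩ p _ m hm j hj
    have hq := Submodule.mkQ_surjective (LinearMap.range f)
    have hC' := ih _ hC ⟨n + 1, (PD.shift hf hq (exact_mkQ f) n).mpr hn⟩
    have : Module.Projective (Localization.AtPrime p)
        (LocalizedModule p.primeCompl (Fin k → A)) := inferInstance
    refine hC' p (m + 1) ?_ j (by omega)
    rwa [PD.shift (LocalizedModule.map_injective p.primeCompl f hf)
        (LocalizedModule.map_surjective p.primeCompl _ hq) (loc_exact _ (exact_mkQ f))]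

lemma exists_dual_surj [IsNoetherianRing A] [Module.Finite A N] :
    ∃ (n : ℕ) (f : N →ₗ[A] (Fin n → A)), ∀ φ : N →ₗ[A] A, ∃ ψ : (Fin n → A) →ₗ[A] A,
      ψ.comp f = φ := by
  obtain ⟨n, s, hs⟩ := Module.Finite.exists_fin (R := A) (M := N →ₗ[A] A)
  refine ⟨n, LinearMap.pi s, fun φ ↦ ?_⟩
  have : φ ∈ Submodule.span A (Set.range s) := by rw [hs]; trivial
  obtain ⟨c, hc⟩ := (Submodule.mem_span_range_iff_exists_fun A).mp this
  refine ⟨∑ k, c k • LinearMap.proj k, ?_⟩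
  rw [← hc]
  ext x
  simp

lemma split_of_free [IsNoetherianRing A] [Module.Finite A N] {n : ℕ} (f : N →ₗ[A] (Fin n → A))
    (hf : ∀ φ : N →ₗ[A] A, ∃ ψ : (Fin n → A) →ₗ[A] A, ψ.comp f = φ) (S : Submonoid A)
    [Module.Free (Localization S) (LocalizedModule S N)] :
    ∃ l : LocalizedModule S (Fin n → A) →ₗ[Localization S] LocalizedModule S N,
      l.comp (LocalizedModule.map S f) = LinearMap.id := by
  have hfp : Module.FinitePresentation A N := Module.finitePresentation_of_finite A N
  have key : ∀ c : LocalizedModule S N →ₗ[Localization S] Localization S,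
      ∃ θ : LocalizedModule S (Fin n → A) →ₗ[Localization S] Localization S,
        θ.comp (LocalizedModule.map S f) = c := by
    intro c
    obtain ⟨φ, s, hφ⟩ := Module.FinitePresentation.exists_lift_of_isLocalizedModule S
      (Algebra.linearMap A (Localization S))
      ((c.restrictScalars A).comp (LocalizedModule.mkLinearMap S N))
    obtain ⟨ψ, hψ⟩ := hf φ
    let θ := IsLocalizedModule.mapExtendScalars S (LocalizedModule.mkLinearMap S (Fin n → A))
      (Algebra.linearMap A (Localization S)) (Localization S) ψ
    refine ⟨Localization.mk 1 s • θ, ?_⟩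
    have hx : ∀ x : N, (Localization.mk 1 s • θ) (LocalizedModule.map S f
        (LocalizedModule.mk x 1)) = c (LocalizedModule.mk x 1) := by
      intro x
      have h1 : θ (LocalizedModule.mkLinearMap S (Fin n → A) (f x)) =
          algebraMap A (Localization S) (ψ (f x)) := by
        simp only [θ, IsLocalizedModule.mapExtendScalars_apply_apply]
        exact IsLocalizedModule.map_apply S _ _ ψ (f x)
      have h2 : algebraMap A (Localization S) (φ x) = (s : A) • c (LocalizedModule.mk x 1) :=
        LinearMap.congr_fun hφ x
      rw [LocalizedModule.map_mk, LinearMap.smul_apply]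
      rw [LocalizedModule.mkLinearMap_apply] at h1
      rw [h1, ← LinearMap.comp_apply, hψ, h2, smul_eq_mul, Algebra.smul_def, ← mul_assoc,
        ← Localization.mk_one_eq_algebraMap, Localization.mk_mul, one_mul,
        mul_one, Localization.mk_self, one_mul]
    have hR : ((Localization.mk 1 s • θ).comp (LocalizedModule.map S f)).restrictScalars A =
        c.restrictScalars A := by
      apply IsLocalizedModule.linearMap_ext S (LocalizedModule.mkLinearMap S N)
        (Algebra.linearMap A (Localization S))
      ext x
      exact hx x
    ext x
    exact LinearMap.congr_fun hR x
  choose θ hθ using key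
  let b := Module.Free.chooseBasis (Localization S) (LocalizedModule S N)
  refine ⟨∑ k, (θ (b.coord k)).smulRight (b k), ?_⟩
  ext x
  have : ∀ k, θ (b.coord k) (LocalizedModule.map S f x) = b.coord k x := fun k ↦
    LinearMap.congr_fun (hθ (b.coord k)) x
  simp [this, b.sum_repr]

lemma syzygy_of_gp [IsNoetherianRing A] (i : ℕ) : ∀ (N : Type) [AddCommGroup N] [Module A N]
    [Module.Finite A N], GP A N i → (∃ n, PD A N n) → IsSyzygy A i N := by
  induction i with
  | zero => intros; trivial
  | succ i ih =>
    rintro N _ _ _ hG ⟨n, hn⟩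
    obtain ⟨k, f, hf⟩ := exists_dual_surj (A := A) (N := N)
    have hsplit : ∀ (p : Ideal A) [p.IsPrime],
        PD (Localization.AtPrime p) (LocalizedModule p.primeCompl N) 0 →
        ∃ l : LocalizedModule p.primeCompl (Fin k → A) →ₗ[Localization.AtPrime p]
          LocalizedModule p.primeCompl N,
          l.comp (LocalizedModule.map p.primeCompl f) = LinearMap.id := by
      intro p _ h
      have := PD.proj_iff.mp h
      have : Module.Free (Localization.AtPrime p) (LocalizedModule p.primeCompl N) :=
        Module.free_of_flat_of_isLocalRing
      exact split_of_free f hf p.primeCompl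
    have hinj : Function.Injective f := by
      rw [← LinearMap.ker_eq_bot, ← Submodule.subsingleton_iff_eq_bot]
      by_contra hns
      have hnt := not_subsingleton_iff_nontrivial.mp hns
      obtain ⟨p, hp⟩ := associatedPrimes.nonempty A (LinearMap.ker f)
      have hp' : p.IsPrime := IsAssociatedPrime.isPrime hp
      obtain ⟨x, hx⟩ : ∃ x : LinearMap.ker f, ∀ a, a ∈ p ↔ a • x = 0 := by
        obtain ⟨-, x, hx⟩ := isAssociatedPrime_iff.mp hp
        exact ⟨x, fun a ↦ by rw [hx, Submodule.mem_colon_singleton, Submodule.mem_bot]⟩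
      have hx0 : (LocalizedModule.mk (x : N) 1 : LocalizedModule p.primeCompl N) ≠ 0 := by
        intro h
        obtain ⟨s, hs⟩ := LocalizedModule.mk_eq.mp (h.trans (LocalizedModule.zero_mk 1).symm)
        apply s.2
        show (s : A) ∈ p
        rw [hx]
        apply Subtype.ext
        simpa [Submonoid.smul_def] using hs
      by_cases h0 : PD (Localization.AtPrime p) (LocalizedModule p.primeCompl N) 0
      · obtain ⟨l, hl⟩ := hsplit p h0
        apply hx0
        have := LinearMap.congr_fun hl (LocalizedModule.mk (x : N) 1)
        rw [LinearMap.comp_apply, LocalizedModule.map_mk, x.2, LocalizedModule.zero_mk,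
          map_zero] at this
        exact this.symm
      · classical
        have hex : ∃ n, PD (Localization.AtPrime p) (LocalizedModule p.primeCompl N) n :=
          ⟨n, hn.loc _⟩
        have hq : Nat.find hex ≠ 0 := fun h ↦ h0 (h ▸ Nat.find_spec hex)
        obtain ⟨q, hq⟩ := Nat.exists_eq_succ_of_ne_zero hq
        have hq1 : PD (Localization.AtPrime p) (LocalizedModule p.primeCompl N) (q + 1) := by
          have := Nat.find_spec hex; rwa [hq] at this
        have hE := depth_ge (R := Localization.AtPrime p) (q + 1) _ 0 hq1
          (fun j hj ↦ hG p q (Nat.find_min hex (by omega)) j (by omega))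
        let φ : (Localization.AtPrime p ⧸ maximalIdeal (Localization.AtPrime p))
            →ₗ[Localization.AtPrime p] LocalizedModule p.primeCompl N :=
          Submodule.liftQ _ (LinearMap.toSpanSingleton (Localization.AtPrime p)
            (LocalizedModule p.primeCompl N) (LocalizedModule.mk (x : N) 1)) (by
              rw [← Localization.AtPrime.map_eq_maximalIdeal]
              refine Ideal.map_le_iff_le_comap.mpr fun a ha ↦ ?_
              have hax : a • (x : N) = 0 := congrArg Subtype.val ((hx a).mp ha)
              change algebraMap A (Localization.AtPrime p) a •
                (LocalizedModule.mk (x : N) 1 : LocalizedModule p.primeCompl N) = 0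
              rw [algebraMap_smul, LocalizedModule.smul'_mk, hax, LocalizedModule.zero_mk])
        have h3 := EZ.zero_hom hE φ
        apply hx0
        have h4 : (1 : Localization.AtPrime p) •
            (LocalizedModule.mk (x : N) 1 : LocalizedModule p.primeCompl N) = 0 :=
          LinearMap.congr_fun h3 (Submodule.Quotient.mk 1)
        rwa [one_smul] at h4
    have hq := Submodule.mkQ_surjective (LinearMap.range f)
    refine ⟨k, f, hinj, ih _ ?_ ⟨n + 1, (PD.shift hinj hq (exact_mkQ f) n).mpr hn⟩⟩
    intro p _ m hm j hj
    have hfi := LocalizedModule.map_injective p.primeCompl f hinj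
    have hqs := LocalizedModule.map_surjective p.primeCompl _ hq
    have hex := loc_exact p.primeCompl (exact_mkQ f)
    have : Module.Projective (Localization.AtPrime p)
        (LocalizedModule p.primeCompl (Fin k → A)) := inferInstance
    rcases m with _ | m
    · by_cases h0 : PD (Localization.AtPrime p) (LocalizedModule p.primeCompl N) 0
      · exfalso
        apply hm
        obtain ⟨l, hl⟩ := hsplit p h0
        rw [PD.proj_iff]
        obtain ⟨s, hs⟩ : ∃ s, (LocalizedModule.map p.primeCompl (LinearMap.range f).mkQ).comp s
            = LinearMap.id :=
          ⟨_, ((hex.splitSurjectiveEquiv hfi).symm ⟨_, (hex.splitInjectiveEquiv hqs ⟨l, hl⟩).2⟩).2⟩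
        exact Module.Projective.of_split s _ hs
      · exact hG p 0 h0 j (by omega)
    · rw [PD.shift hfi hqs hex] at hm
      exact hG p m hm j (by omega)

end
end Syz

/-- **Corollary 13.** If in a short exact sequence `0 → M' → M → M'' → 0` of
finitely generated modules the outer terms are `i`-th syzygies of finite projective
dimension, then so is the middle term. -/
theorem isSyzygy_middle_of_shortExact
    (A : Type) [CommRing A] [IsNoetherianRing A] [IsLocalRing A]
    (M' M M'' : Type) [AddCommGroup M'] [Module A M'] [Module.Finite A M']
    [AddCommGroup M] [Module A M] [Module.Finite A M]
    [AddCommGroup M''] [Module A M''] [Module.Finite A M'']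
    (f : M' →ₗ[A] M) (g : M →ₗ[A] M'')
    (hf : Function.Injective f) (hg : Function.Surjective g)
    (hfg : LinearMap.ker g = LinearMap.range f)
    (i : ℕ)
    (h1 : IsSyzygy A i M') (h1pd : HasFinitePD A M')
    (h2 : IsSyzygy A i M'') (h2pd : HasFinitePD A M'') :
    IsSyzygy A i M ∧ HasFinitePD A M := by
  have hex : Function.Exact f g := LinearMap.exact_iff.mpr hfg
  rw [Syz.finitePD_iff] at *
  have hM : ∃ n, Syz.PD A M n := by
    obtain ⟨a, ha⟩ := h1pd
    obtain ⟨b, hb⟩ := h2pd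
    exact ⟨max a b, Syz.PD.mid hf hg hex (ha.mono (le_max_left _ _)) (hb.mono (le_max_right _ _))⟩
  exact ⟨Syz.syzygy_of_gp i M (Syz.GP.mid hf hg hex (Syz.gp_of_syzygy i M' h1 h1pd)
    (Syz.gp_of_syzygy i M'' h2 h2pd)) hM, hM⟩
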